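/- Let G be a Θ1-graph with branch vertices x and y joined by four internally disjoint paths, and let e = uv be an edge lying on the path P_i, with u on the x-side of e along P_i. Let a_i be the distance along P_i from x to u and b_i the distance along P_i from v to y. If x ∈ N_u(e) and y ∈ N_v(e), then |n_u(e) − n_v(e)| = 2|b_i − a_i|. -/

import Mathlib

attribute [local instance] Classical.propDecidable

noncomputable def nC {V : Type*} [Fintype V] (G : SimpleGraph V) (u v : V) : ℕ :=
  (Finset.univ.filter fun w => G.dist u w < G.dist v w).card

/-- Two paths are internally disjoint if every common vertex is an endpoint of both. -/
def IntDisj {V : Type*} {G : SimpleGraph V} {x y x' y' : V}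
    (P : G.Walk x y) (Q : G.Walk x' y') : Prop :=
  ∀ v : V, v ∈ P.support → v ∈ Q.support → (v = x ∨ v = y) ∧ (v = x' ∨ v = y')
/-- `G` consists of the two distinct vertices `x, y` joined by the four pairwise
internally disjoint paths `P₁, P₂, P₃, P₄`, every vertex and every edge of `G`
lying on one of these paths. -/
def Theta1Cond {V : Type*} (G : SimpleGraph V) (x y : V)
    (P₁ P₂ P₃ P₄ : G.Walk x y) : Prop :=
  x ≠ y ∧
  P₁.IsPath ∧ P₂.IsPath ∧ P₃.IsPath ∧ P₄.IsPath ∧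
  1 ≤ P₁.length ∧ 1 ≤ P₂.length ∧ 1 ≤ P₃.length ∧ 1 ≤ P₄.length ∧
  P₁ ≠ P₂ ∧ P₁ ≠ P₃ ∧ P₁ ≠ P₄ ∧ P₂ ≠ P₃ ∧ P₂ ≠ P₄ ∧ P₃ ≠ P₄ ∧
  IntDisj P₁ P₂ ∧ IntDisj P₁ P₃ ∧ IntDisj P₁ P₄ ∧
  IntDisj P₂ P₃ ∧ IntDisj P₂ P₄ ∧ IntDisj P₃ P₄ ∧
  (∀ v : V, v ∈ P₁.support ∨ v ∈ P₂.support ∨ v ∈ P₃.support ∨ v ∈ P₄.support) ∧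
  (∀ e ∈ G.edgeSet, e ∈ P₁.edges ∨ e ∈ P₂.edges ∨ e ∈ P₃.edges ∨ e ∈ P₄.edges)

/-- `G` is a Θ₁-graph. -/
def IsTheta1 {V : Type*} (G : SimpleGraph V) : Prop :=
  ∃ (x y : V) (P₁ P₂ P₃ P₄ : G.Walk x y), Theta1Cond G x y P₁ P₂ P₃ P₄

/-- `Q` is a path whose internal vertices have no neighbours outside the path. -/
def IsThread {V : Type*} {G : SimpleGraph V} {x y : V} (Q : G.Walk x y) : Prop :=
  Q.IsPath ∧ ∀ i, 0 < i → i < Q.length → ∀ q, G.Adj (Q.getVert i) q →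
    q = Q.getVert (i - 1) ∨ q = Q.getVert (i + 1)

/-- The contribution of the vertex `w` to `n_u - n_v`. -/
noncomputable def sideSign {V : Type*} (G : SimpleGraph V) (u v w : V) : ℤ :=
  (if G.dist u w < G.dist v w then 1 else 0) - (if G.dist v w < G.dist u w then 1 else 0)

theorem nC_sub_nC {V : Type*} [Fintype V] (G : SimpleGraph V) (u v : V) :
    (nC G u v : ℤ) - nC G v u = ∑ w, sideSign G u v w := by
  simp only [sideSign, Finset.sum_sub_distrib, Finset.sum_boole, nC]

section Thread

variable {V : Type*} {G : SimpleGraph V} {x y : V} {Q : G.Walk x y}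

theorem getVert_inj (hQ : Q.IsPath) {i j : ℕ} (hi : i ≤ Q.length) (hj : j ≤ Q.length)
    (h : Q.getVert i = Q.getVert j) : i = j :=
  hQ.getVert_injOn hi hj h

theorem isThread_of_edges (hQ : Q.IsPath)
    (h : ∀ e ∈ G.edgeSet, e ∈ Q.edges ∨ ∃ R : G.Walk x y, IntDisj Q R ∧ e ∈ R.edges) :
    IsThread Q := by
  refine ⟨hQ, fun i hi0 hil q hq => ?_⟩
  rcases h s(Q.getVert i, q) hq with he | ⟨R, hR, he⟩
  · rw [← Q.mem_edges_toSubgraph, SimpleGraph.Subgraph.mem_edgeSet, Q.toSubgraph_adj_iff] at he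
    obtain ⟨j, hj, hjl⟩ := he
    rw [Sym2.eq_iff] at hj
    rcases hj with ⟨h1, h2⟩ | ⟨h1, h2⟩
    · obtain rfl := getVert_inj hQ (by omega) (by omega) h1
      exact Or.inr h2.symm
    · obtain rfl := getVert_inj hQ (by omega) (by omega) h2
      exact Or.inl (by simpa using h1.symm)
  · rcases (hR _ (Q.getVert_mem_support i) (R.fst_mem_support_of_mem_edges he)).1 with h1 | h1
    · rw [hQ.getVert_eq_start_iff hil.le] at h1
      omega
    · rw [hQ.getVert_eq_end_iff hil.le] at h1
      omega

/-- A walk starting on a thread either leaves it through an end or stays on it. -/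
theorem IsThread.length_walk (hQ : IsThread Q) {z w : V} (p : G.Walk z w) :
    ∀ i ≤ Q.length, z = Q.getVert i →
      i + G.dist x w ≤ p.length ∨ Q.length - i + G.dist y w ≤ p.length ∨
      ∃ j ≤ Q.length, w = Q.getVert j ∧ i ≤ j + p.length ∧ j ≤ i + p.length := by
  induction p with
  | nil => exact fun i hi hz => Or.inr (Or.inr ⟨i, hi, hz, by simp, by simp⟩)
  | @cons z z' w hadj p ih =>
    intro i hi hz
    subst hz
    rcases Nat.eq_zero_or_pos i with rfl | hi0
    · left
      have := G.dist_le (SimpleGraph.Walk.cons hadj p)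
      simpa using this
    rcases hi.eq_or_lt with rfl | hil
    · right; left
      have := G.dist_le (SimpleGraph.Walk.cons hadj p)
      simpa using this
    rw [SimpleGraph.Walk.length_cons]
    rcases hQ.2 i hi0 hil _ hadj with h | h
    · rcases ih _ (by omega) h with h | h | ⟨j, hj, hw, h1, h2⟩
      · left; omega
      · right; left; omega
      · exact Or.inr (Or.inr ⟨j, hj, hw, by omega, by omega⟩)
    · rcases ih _ (by omega) h with h | h | ⟨j, hj, hw, h1, h2⟩
      · left; omega
      · right; left; omega
      · exact Or.inr (Or.inr ⟨j, hj, hw, by omega, by omega⟩)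

theorem IsThread.le_dist (hQ : IsThread Q) (hG : G.Connected) {i : ℕ} (hi : i ≤ Q.length) (w : V) :
    i + G.dist x w ≤ G.dist (Q.getVert i) w ∨
    Q.length - i + G.dist y w ≤ G.dist (Q.getVert i) w ∨
    ∃ j ≤ Q.length, w = Q.getVert j ∧ i ≤ j + G.dist (Q.getVert i) w ∧
      j ≤ i + G.dist (Q.getVert i) w := by
  obtain ⟨p, hp⟩ := hG.exists_walk_length_eq_dist (Q.getVert i) w
  rw [← hp]
  exact hQ.length_walk p i hi rfl

theorem dist_getVert_le (Q : G.Walk x y) (i n : ℕ) :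
    G.dist (Q.getVert i) (Q.getVert (i + n)) ≤ n := by
  simpa using (G.dist_le ((Q.drop i).take n)).trans (by simp)

theorem dist_getVert_start_le (Q : G.Walk x y) (i : ℕ) : G.dist (Q.getVert i) x ≤ i := by
  simpa [G.dist_comm] using dist_getVert_le Q 0 i

theorem dist_getVert_end_le (Q : G.Walk x y) {i : ℕ} (hi : i ≤ Q.length) :
    G.dist (Q.getVert i) y ≤ Q.length - i := by
  simpa [Nat.add_sub_cancel' hi] using dist_getVert_le Q i (Q.length - i)

theorem IsThread.le_dist_start (hQ : IsThread Q) (hG : G.Connected) {i : ℕ} (hi : i ≤ Q.length) :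
    i ≤ G.dist (Q.getVert i) x ∨ Q.length - i + G.dist x y ≤ G.dist (Q.getVert i) x := by
  rcases hQ.le_dist hG hi x with h | h | ⟨j, hj, hw, h, -⟩
  · left; omega
  · right; rwa [G.dist_comm (u := y)] at h
  · have := (hQ.1.getVert_eq_start_iff hj).1 hw.symm
    left; omega

theorem IsThread.le_dist_end (hQ : IsThread Q) (hG : G.Connected) {i : ℕ} (hi : i ≤ Q.length) :
    Q.length - i ≤ G.dist (Q.getVert i) y ∨ i + G.dist x y ≤ G.dist (Q.getVert i) y := by
  rcases hQ.le_dist hG hi y with h | h | ⟨j, hj, hw, -, h⟩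
  · right; exact h
  · left; omega
  · have := (hQ.1.getVert_eq_end_iff hj).1 hw.symm
    left; omega

/-- The distances from the ends of the `k`-th edge of a thread to the branch vertices, when the
edge separates those vertices. -/
theorem IsThread.dist_edge {P : G.Walk x y} (hP : IsThread P) (hG : G.Connected) {k : ℕ}
    (hk : k < P.length)
    (hx : G.dist (P.getVert k) x < G.dist (P.getVert (k + 1)) x)
    (hy : G.dist (P.getVert (k + 1)) y < G.dist (P.getVert k) y) :
    G.dist (P.getVert k) x = k ∧ G.dist (P.getVert (k + 1)) x = k + 1 ∧
    G.dist (P.getVert (k + 1)) y + k + 1 = P.length ∧ G.dist (P.getVert k) y + k = P.length ∧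
    2 * k + 2 ≤ P.length + G.dist x y ∧ P.length ≤ 2 * k + G.dist x y := by
  have h1 := hP.le_dist_start hG hk.le
  have h2 := hP.le_dist_end (i := k + 1) hG hk
  have h3 := dist_getVert_start_le P k
  have h4 := dist_getVert_start_le P (k + 1)
  have h5 := dist_getVert_end_le P hk.le
  have h6 := dist_getVert_end_le (i := k + 1) P hk
  have h7 := hG.dist_triangle (u := P.getVert (k + 1)) (v := y) (w := x)
  have h8 := hG.dist_triangle (u := P.getVert k) (v := x) (w := y)
  have h9 := G.dist_comm (u := x) (v := y)
  omega

theorem IsThread.sideSign_of_le {P : G.Walk x y} (hP : IsThread P) (hG : G.Connected) {k : ℕ}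
    (hk : k < P.length)
    (hx : G.dist (P.getVert k) x < G.dist (P.getVert (k + 1)) x)
    (hy : G.dist (P.getVert (k + 1)) y < G.dist (P.getVert k) y) {i : ℕ} (hi : i ≤ k) :
    sideSign G (P.getVert k) (P.getVert (k + 1)) (P.getVert i) = 1 := by
  obtain ⟨-, -, -, -, h5, h6⟩ := hP.dist_edge hG hk hx hy
  have h1 := dist_getVert_le P i (k - i)
  rw [Nat.add_sub_cancel' hi, G.dist_comm] at h1
  have h2 := hP.le_dist (i := k + 1) hG hk (P.getVert i)
  have h3 := dist_getVert_start_le P i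
  have h4 := hG.dist_triangle (u := x) (v := P.getVert i) (w := y)
  have h7 := G.dist_comm (u := x) (v := P.getVert i)
  have h8 := G.dist_comm (u := y) (v := P.getVert i)
  have h : G.dist (P.getVert k) (P.getVert i) < G.dist (P.getVert (k + 1)) (P.getVert i) := by
    rcases h2 with h2 | h2 | ⟨j, hj, hw, h2, -⟩
    · omega
    · omega
    · have := getVert_inj hP.1 (by omega) hj hw
      omega
  simp [sideSign, h, h.le]

theorem IsThread.sideSign_of_lt {P : G.Walk x y} (hP : IsThread P) (hG : G.Connected) {k : ℕ}
    (hx : G.dist (P.getVert k) x < G.dist (P.getVert (k + 1)) x)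
    (hy : G.dist (P.getVert (k + 1)) y < G.dist (P.getVert k) y) {i : ℕ} (hki : k < i)
    (hi : i ≤ P.length) :
    sideSign G (P.getVert k) (P.getVert (k + 1)) (P.getVert i) = -1 := by
  have hk : k < P.length := by omega
  obtain ⟨-, -, -, -, h5, h6⟩ := hP.dist_edge hG hk hx hy
  have h1 := dist_getVert_le P (k + 1) (i - (k + 1))
  rw [Nat.add_sub_cancel' hki] at h1
  have h2 := hP.le_dist hG hk.le (P.getVert i)
  have h3 := dist_getVert_end_le P hi
  have h4 := hG.dist_triangle (u := x) (v := P.getVert i) (w := y)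
  have h8 := G.dist_comm (u := y) (v := P.getVert i)
  have h : G.dist (P.getVert (k + 1)) (P.getVert i) < G.dist (P.getVert k) (P.getVert i) := by
    rcases h2 with h2 | h2 | ⟨j, hj, hw, -, h2⟩
    · omega
    · omega
    · have := getVert_inj hP.1 (by omega) hj hw
      omega
  simp [sideSign, h, h.le]

theorem IsThread.sideSign_of_notMem {P : G.Walk x y} (hP : IsThread P) (hQ : IsThread Q)
    (hG : G.Connected) {k : ℕ} (hk : k < P.length)
    (hx : G.dist (P.getVert k) x < G.dist (P.getVert (k + 1)) x)
    (hy : G.dist (P.getVert (k + 1)) y < G.dist (P.getVert k) y) {j : ℕ} (hj : j ≤ Q.length)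
    (hjP : Q.getVert j ∉ P.support) :
    sideSign G (P.getVert k) (P.getVert (k + 1)) (Q.getVert j) =
      (if 2 * j + 2 * k + 1 < Q.length + P.length then 1 else 0) -
      (if Q.length + P.length < 2 * j + 2 * k + 1 then 1 else 0) := by
  have key : ∀ i ≤ P.length,
      i + G.dist x (Q.getVert j) ≤ G.dist (P.getVert i) (Q.getVert j) ∨
      P.length - i + G.dist y (Q.getVert j) ≤ G.dist (P.getVert i) (Q.getVert j) := by
    intro i hi
    rcases hP.le_dist hG hi (Q.getVert j) with h | h | ⟨m, -, hw, -⟩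
    · exact Or.inl h
    · exact Or.inr h
    · exact absurd (hw ▸ P.getVert_mem_support m) hjP
  obtain ⟨e1, e2, e3, e4, e5, e6⟩ := hP.dist_edge hG hk hx hy
  have a1 := key k hk.le
  have a2 := key (k + 1) hk
  have b1 := hG.dist_triangle (u := P.getVert k) (v := x) (w := Q.getVert j)
  have b2 := hG.dist_triangle (u := P.getVert k) (v := y) (w := Q.getVert j)
  have b3 := hG.dist_triangle (u := P.getVert (k + 1)) (v := x) (w := Q.getVert j)
  have b4 := hG.dist_triangle (u := P.getVert (k + 1)) (v := y) (w := Q.getVert j)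
  have c1 := dist_getVert_start_le Q j
  have c2 := dist_getVert_end_le Q hj
  have c3 := hG.dist_triangle (u := Q.getVert j) (v := x) (w := y)
  have c4 := hG.dist_triangle (u := Q.getVert j) (v := y) (w := x)
  have c5 := hQ.le_dist_start hG hj
  have c6 := hQ.le_dist_end hG hj
  have d1 := G.dist_comm (u := x) (v := Q.getVert j)
  have d2 := G.dist_comm (u := y) (v := Q.getVert j)
  have d3 := G.dist_comm (u := x) (v := y)
  have d4 := G.dist_le P
  have d5 := G.dist_le Q
  have h1 : G.dist (P.getVert k) (Q.getVert j) < G.dist (P.getVert (k + 1)) (Q.getVert j) ↔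
      k + G.dist x (Q.getVert j) + k + 1 < P.length + G.dist y (Q.getVert j) := by omega
  have h2 : G.dist (P.getVert (k + 1)) (Q.getVert j) < G.dist (P.getVert k) (Q.getVert j) ↔
      P.length + G.dist y (Q.getVert j) < k + G.dist x (Q.getVert j) + k + 1 := by omega
  clear a1 a2 b1 b2 b3 b4 key
  have h3 : k + G.dist x (Q.getVert j) + k + 1 < P.length + G.dist y (Q.getVert j) ↔
      2 * j + 2 * k + 1 < Q.length + P.length := by omega
  have h4 : P.length + G.dist y (Q.getVert j) < k + G.dist x (Q.getVert j) + k + 1 ↔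
      Q.length + P.length < 2 * j + 2 * k + 1 := by omega
  simp only [sideSign, h1.trans h3, h2.trans h4]

end Thread

theorem sum_Ioo_sign {l s t : ℕ} (hst : t < l + s) (hts : s < l + t) :
    ∑ j ∈ Finset.Ioo 0 l, (((if 2 * j + s < l + t then 1 else 0) : ℤ) -
      (if l + t < 2 * j + s then 1 else 0)) = (t : ℤ) - s := by
  have h1 : (Finset.Ioo 0 l).filter (fun j => 2 * j + s < l + t) =
      Finset.Ico 1 ((l + t - s + 1) / 2) := by
    ext j
    simp only [Finset.mem_filter, Finset.mem_Ioo, Finset.mem_Ico]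
    omega
  have h2 : (Finset.Ioo 0 l).filter (fun j => l + t < 2 * j + s) =
      Finset.Ico ((l + t - s) / 2 + 1) l := by
    ext j
    simp only [Finset.mem_filter, Finset.mem_Ioo, Finset.mem_Ico]
    omega
  rw [Finset.sum_sub_distrib, Finset.sum_boole, Finset.sum_boole, h1, h2, Nat.card_Ico,
    Nat.card_Ico]
  omega

section Sums

variable {V : Type*} {G : SimpleGraph V} {x y : V}

theorem IsThread.sum_sideSign_self {P : G.Walk x y} (hP : IsThread P) (hG : G.Connected) {k : ℕ}
    (hk : k < P.length)
    (hx : G.dist (P.getVert k) x < G.dist (P.getVert (k + 1)) x)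
    (hy : G.dist (P.getVert (k + 1)) y < G.dist (P.getVert k) y) :
    ∑ w ∈ P.support.toFinset, sideSign G (P.getVert k) (P.getVert (k + 1)) w =
      2 * k + 2 - (P.length + 1) := by
  have himg : P.support.toFinset = (Finset.range (P.length + 1)).image P.getVert := by
    ext w
    simp only [List.mem_toFinset, SimpleGraph.Walk.mem_support_iff_exists_getVert,
      Finset.mem_image, Finset.mem_range, Nat.lt_succ_iff, and_comm]
  rw [himg, Finset.sum_image fun i hi j hj h => getVert_inj hP.1
    (Finset.mem_range_succ_iff.1 hi) (Finset.mem_range_succ_iff.1 hj) h,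
    ← Finset.sum_range_add_sum_Ico _ (show k + 1 ≤ P.length + 1 by omega),
    Finset.sum_congr rfl fun i hi => hP.sideSign_of_le hG hk hx hy (Finset.mem_range_succ_iff.1 hi),
    Finset.sum_congr rfl fun i hi => hP.sideSign_of_lt hG hx hy
      (Finset.mem_Ico.1 hi).1 (Nat.lt_succ_iff.1 (Finset.mem_Ico.1 hi).2)]
  simp
  omega

/-- The internal vertices of a walk. -/
noncomputable def internalVerts (Q : G.Walk x y) : Finset V :=
  Q.support.toFinset \ {x, y}

theorem mem_internalVerts {Q : G.Walk x y} {w : V} :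
    w ∈ internalVerts Q ↔ w ∈ Q.support ∧ w ≠ x ∧ w ≠ y := by
  simp [internalVerts]

theorem IntDisj.disjoint_internalVerts {P Q : G.Walk x y} (h : IntDisj P Q) :
    Disjoint P.support.toFinset (internalVerts Q) := by
  rw [Finset.disjoint_left]
  intro w hw hw'
  rw [mem_internalVerts] at hw'
  rcases (h w (List.mem_toFinset.1 hw) hw'.1).1 with h | h
  · exact hw'.2.1 h
  · exact hw'.2.2 h

theorem IntDisj.symm {P Q : G.Walk x y} (h : IntDisj P Q) : IntDisj Q P :=
  fun v hv hv' => (h v hv' hv).symm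

theorem internalVerts_eq_image {Q : G.Walk x y} (hQ : Q.IsPath) :
    internalVerts Q = (Finset.Ioo 0 Q.length).image Q.getVert := by
  ext w
  simp only [mem_internalVerts, SimpleGraph.Walk.mem_support_iff_exists_getVert, Finset.mem_image,
    Finset.mem_Ioo]
  constructor
  · rintro ⟨⟨i, rfl, hi⟩, h1, h2⟩
    rw [Ne, hQ.getVert_eq_start_iff hi] at h1
    rw [Ne, hQ.getVert_eq_end_iff hi] at h2
    exact ⟨i, by omega, rfl⟩
  · rintro ⟨i, hi, rfl⟩
    rw [Ne, hQ.getVert_eq_start_iff hi.2.le, Ne, hQ.getVert_eq_end_iff hi.2.le]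
    exact ⟨⟨i, rfl, hi.2.le⟩, by omega, by omega⟩

theorem IsThread.sum_sideSign_internalVerts {P Q : G.Walk x y} (hP : IsThread P) (hQ : IsThread Q)
    (hG : G.Connected) (hPQ : IntDisj P Q) {k : ℕ} (hk : k < P.length)
    (hx : G.dist (P.getVert k) x < G.dist (P.getVert (k + 1)) x)
    (hy : G.dist (P.getVert (k + 1)) y < G.dist (P.getVert k) y) :
    ∑ w ∈ internalVerts Q, sideSign G (P.getVert k) (P.getVert (k + 1)) w =
      (P.length : ℤ) - (2 * k + 1) := by
  obtain ⟨-, -, -, -, h5, h6⟩ := hP.dist_edge hG hk hx hy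
  have hD := G.dist_le Q
  have hinj : Set.InjOn Q.getVert (Finset.Ioo 0 Q.length) := fun i hi j hj h =>
    getVert_inj hQ.1 (Finset.mem_Ioo.1 hi).2.le (Finset.mem_Ioo.1 hj).2.le h
  have hsum := sum_Ioo_sign (l := Q.length) (s := 2 * k + 1) (t := P.length)
    (by omega) (by omega)
  rw [internalVerts_eq_image hQ.1, Finset.sum_image hinj]
  push_cast at hsum
  rw [← hsum]
  refine Finset.sum_congr rfl fun j hj => ?_
  refine hP.sideSign_of_notMem hQ hG hk hx hy (Finset.mem_Ioo.1 hj).2.le fun hmem => ?_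
  refine Finset.disjoint_left.1 hPQ.disjoint_internalVerts (List.mem_toFinset.2 hmem) ?_
  rw [internalVerts_eq_image hQ.1]
  exact Finset.mem_image_of_mem _ hj

theorem internalVerts_subset (Q : G.Walk x y) : internalVerts Q ⊆ Q.support.toFinset :=
  Finset.sdiff_subset

end Sums

theorem Theta1Cond.nC_sub_nC {V : Type*} [Fintype V] {G : SimpleGraph V} {x y : V}
    {P Q R S : G.Walk x y} (hΘ : Theta1Cond G x y P Q R S) {k : ℕ} (hk : k < P.length)
    (hx : G.dist (P.getVert k) x < G.dist (P.getVert (k + 1)) x)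
    (hy : G.dist (P.getVert (k + 1)) y < G.dist (P.getVert k) y) :
    (nC G (P.getVert k) (P.getVert (k + 1)) : ℤ) - nC G (P.getVert (k + 1)) (P.getVert k) =
      2 * ((P.length : ℤ) - (2 * k + 1)) := by
  obtain ⟨-, hP, hQ, hR, hS, -, -, -, -, -, -, -, -, -, -, hPQ, hPR, hPS, hQR, hQS, hRS,
    hV, hE⟩ := hΘ
  have hG : G.Connected := by
    rw [SimpleGraph.connected_iff_exists_forall_reachable]
    refine ⟨x, fun w => ?_⟩
    rcases hV w with h | h | h | h
    exacts [(P.takeUntil w h).reachable, (Q.takeUntil w h).reachable,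
      (R.takeUntil w h).reachable, (S.takeUntil w h).reachable]
  have tP : IsThread P := isThread_of_edges hP fun e he => by
    rcases hE e he with h | h | h | h
    exacts [.inl h, .inr ⟨Q, hPQ, h⟩, .inr ⟨R, hPR, h⟩, .inr ⟨S, hPS, h⟩]
  have tQ : IsThread Q := isThread_of_edges hQ fun e he => by
    rcases hE e he with h | h | h | h
    exacts [.inr ⟨P, hPQ.symm, h⟩, .inl h, .inr ⟨R, hQR, h⟩, .inr ⟨S, hQS, h⟩]
  have tR : IsThread R := isThread_of_edges hR fun e he => by
    rcases hE e he with h | h | h | h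
    exacts [.inr ⟨P, hPR.symm, h⟩, .inr ⟨Q, hQR.symm, h⟩, .inl h, .inr ⟨S, hRS, h⟩]
  have tS : IsThread S := isThread_of_edges hS fun e he => by
    rcases hE e he with h | h | h | h
    exacts [.inr ⟨P, hPS.symm, h⟩, .inr ⟨Q, hQS.symm, h⟩, .inr ⟨R, hRS.symm, h⟩, .inl h]
  have huniv : (Finset.univ : Finset V) =
      P.support.toFinset ∪ internalVerts Q ∪ internalVerts R ∪ internalVerts S := by
    ext w
    have hw := hV w
    have h1 : w = x → w ∈ P.support := fun h => h ▸ P.start_mem_support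
    have h2 : w = y → w ∈ P.support := fun h => h ▸ P.end_mem_support
    simp only [Finset.mem_univ, Finset.mem_union, List.mem_toFinset, mem_internalVerts, true_iff]
    tauto
  rw [_root_.nC_sub_nC, huniv, Finset.sum_union, Finset.sum_union, Finset.sum_union,
    tP.sum_sideSign_self hG hk hx hy, tP.sum_sideSign_internalVerts tQ hG hPQ hk hx hy,
    tP.sum_sideSign_internalVerts tR hG hPR hk hx hy,
    tP.sum_sideSign_internalVerts tS hG hPS hk hx hy]
  · ring
  · exact hPQ.disjoint_internalVerts
  · exact Finset.disjoint_union_left.2 ⟨hPR.disjoint_internalVerts,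
      hQR.disjoint_internalVerts.mono_left (internalVerts_subset Q)⟩
  · exact Finset.disjoint_union_left.2 ⟨Finset.disjoint_union_left.2 ⟨hPS.disjoint_internalVerts,
      hQS.disjoint_internalVerts.mono_left (internalVerts_subset Q)⟩,
      hRS.disjoint_internalVerts.mono_left (internalVerts_subset R)⟩

section Symmetry

variable {V : Type*} {G : SimpleGraph V} {x y : V} {P Q R S : G.Walk x y}

theorem Theta1Cond.rotate (h : Theta1Cond G x y P Q R S) : Theta1Cond G x y Q R S P := by
  obtain ⟨h0, hP, hQ, hR, hS, lP, lQ, lR, lS, nPQ, nPR, nPS, nQR, nQS, nRS, hPQ, hPR, hPS, hQR,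
    hQS, hRS, hV, hE⟩ := h
  refine ⟨h0, hQ, hR, hS, hP, lQ, lR, lS, lP, nQR, nQS, nPQ.symm, nRS, nPR.symm, nPS.symm, hQR,
    hQS, hPQ.symm, hRS, hPR.symm, hPS.symm, fun v => ?_, fun e he => ?_⟩
  · have := hV v
    tauto
  · have := hE e he
    tauto

end Symmetry

/-- In a Θ₁-graph with branch vertices `x, y`, if `e = uv` is the `k`-th edge of one
of the four paths (so that `u` is on the `x`-side, `aᵢ = k` is the distance along the
path from `x` to `u`, and `bᵢ = length − k − 1` is the distance along the path from
`v` to `y`), and `x ∈ N_u(e)`, `y ∈ N_v(e)`, then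
`|n_u(e) − n_v(e)| = 2|bᵢ − aᵢ|`. -/
theorem theta1_diff_of_opposite_sides {V : Type*} [Fintype V] {G : SimpleGraph V}
    {x y : V} {P₁ P₂ P₃ P₄ : G.Walk x y} (hΘ : Theta1Cond G x y P₁ P₂ P₃ P₄)
    (u v : V) (P : G.Walk x y) (hP : P ∈ [P₁, P₂, P₃, P₄]) (k : ℕ) (d : G.Dart)
    (hd : P.darts[k]? = some d) (hduv : d.toProd = (u, v))
    (hx : G.dist u x < G.dist v x) (hy : G.dist v y < G.dist u y) :
    |(nC G u v : ℤ) - (nC G v u : ℤ)| =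
      2 * |((P.length : ℤ) - k - 1) - (k : ℤ)| := by
  obtain ⟨hlen, hget⟩ := List.getElem?_eq_some_iff.1 hd
  have hk : k < P.length := by simpa using hlen
  rw [SimpleGraph.Walk.darts_getElem_eq_getVert] at hget
  obtain ⟨rfl, rfl⟩ : P.getVert k = u ∧ P.getVert (k + 1) = v := by
    subst hget
    exact Prod.mk_inj.1 hduv
  have main : (nC G (P.getVert k) (P.getVert (k + 1)) : ℤ) -
      nC G (P.getVert (k + 1)) (P.getVert k) = 2 * ((P.length : ℤ) - (2 * k + 1)) := by
    simp only [List.mem_cons, List.not_mem_nil, or_false] at hP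
    rcases hP with rfl | rfl | rfl | rfl
    · exact hΘ.nC_sub_nC hk hx hy
    · exact hΘ.rotate.nC_sub_nC hk hx hy
    · exact hΘ.rotate.rotate.nC_sub_nC hk hx hy
    · exact hΘ.rotate.rotate.rotate.nC_sub_nC hk hx hy
  rw [main, abs_mul, abs_two]
  congr 2
  ring
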